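/- For every prime p ≥ 5: deg ss_p^{(3)}(X) − L^{(3)}(p) ≤ 4 if and only if p divides #Fi′₂₄ (the order of Fischer's group Fi′₂₄), and deg ss_p^{(3)}(X) − L^{(3)}(p) ≤ 10 if and only if p divides #𝕄 (the order of the Monster group). -/

import Mathlib

open Polynomial

noncomputable section

/-- The class number h(√-d) of the imaginary quadratic field ℚ(√-d),
realized as the subfield of ℂ generated by i·√d. -/
def classNumberSqrtNeg (d : ℕ) : ℕ :=
  haveI : FiniteDimensional ℚ (IntermediateField.adjoin ℚ {(Complex.I * Real.sqrt d : ℂ)}) :=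
    IntermediateField.adjoin.finiteDimensional
      ⟨X ^ 2 + C (d : ℚ), monic_X_pow_add_C _ (by norm_num), by
        have h : (Complex.I * (Real.sqrt d : ℂ)) ^ 2 = -(d : ℂ) := by
          rw [mul_pow, Complex.I_sq, ← Complex.ofReal_pow, Real.sq_sqrt (Nat.cast_nonneg d)]
          simp
        simp [h]⟩
  haveI : NumberField (IntermediateField.adjoin ℚ {(Complex.I * Real.sqrt d : ℂ)}) := ⟨⟩
  NumberField.classNumber (IntermediateField.adjoin ℚ {(Complex.I * Real.sqrt d : ℂ)})

variable (p : ℕ) [Fact p.Prime]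

/-- ε = (1 - (-1|p))/2 -/
def eps : ℕ := ((1 - legendreSym p (-1)) / 2).toNat
/-- δ = (1 - (-3|p))/2 -/
def del : ℕ := ((1 - legendreSym p (-3)) / 2).toNat
/-- ν = (1 - (-2|p))/2 -/
def nu : ℕ := ((1 - legendreSym p (-2)) / 2).toNat

/-- The Pochhammer symbol (x)_n = x(x+1)⋯(x+n-1) in 𝔽_p. -/
def poch (x : ZMod p) (n : ℕ) : ZMod p := (ascPochhammer (ZMod p) n).eval x

/-- The level-3 supersingular polynomial ss_p^{(3)}(X) ∈ 𝔽_p[X]: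
Σ_{n=0}^{m} ((-m)_n (2/3-δ/3)_n / (n!)²) 27^n X^{m+δ-n}, with m = ⌊p/3⌋. -/
def ss3Poly : (ZMod p)[X] :=
  ∑ n ∈ Finset.range (p / 3 + 1),
    C (poch p (-(p / 3 : ℕ) : ZMod p) n *
       poch p ((2 : ZMod p) / 3 - (del p : ZMod p) / 3) n /
       ((n.factorial : ZMod p)) ^ 2 * 27 ^ n) *
    X ^ (p / 3 + del p - n)

/-- L^{(3)}(p): the number of distinct roots of ss_p^{(3)}(X) in 𝔽_p. -/
def L3 : ℕ := (ss3Poly p).roots.toFinset.card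

/-- The order of the Monster simple group 𝕄. -/
def monsterOrder : ℕ :=
  2 ^ 46 * 3 ^ 20 * 5 ^ 9 * 7 ^ 6 * 11 ^ 2 * 13 ^ 3 * 17 * 19 * 23 * 29 * 31 * 41 * 47 * 59 * 71

/-- The order of the Baby monster group 𝔹. -/
def babyMonsterOrder : ℕ :=
  2 ^ 41 * 3 ^ 13 * 5 ^ 6 * 7 ^ 2 * 11 * 13 * 17 * 19 * 23 * 31 * 47

/-- The order of Fischer's sporadic group Fi′₂₄. -/
def fischer24Order : ℕ :=
  2 ^ 21 * 3 ^ 16 * 5 ^ 2 * 7 ^ 3 * 11 * 13 * 17 * 23 * 29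

/-- The multinomial coefficient (3n)! / (n!)³. -/
def tripleChoose (n : ℕ) : ℕ := (3 * n).choose n * (2 * n).choose n

theorem tripleChoose_mul_factorial (n : ℕ) :
    tripleChoose n * n.factorial ^ 3 = (3 * n).factorial := by
  have h1 := Nat.choose_mul_factorial_mul_factorial (show n ≤ 3 * n by omega)
  have h2 := Nat.choose_mul_factorial_mul_factorial (show n ≤ 2 * n by omega)
  rw [show 3 * n - n = 2 * n by omega] at h1
  rw [show 2 * n - n = n by omega] at h2
  rw [← h1, ← h2, tripleChoose]
  ring

theorem tripleChoose_zero : tripleChoose 0 = 1 := by simp [tripleChoose]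

theorem tripleChoose_succ (n : ℕ) :
    (n + 1) ^ 2 * tripleChoose (n + 1) = 3 * ((3 * n + 1) * (3 * n + 2)) * tripleChoose n := by
  have h1 := tripleChoose_mul_factorial n
  have h2 := tripleChoose_mul_factorial (n + 1)
  rw [show 3 * (n + 1) = 3 * n + 1 + 1 + 1 by ring, Nat.factorial_succ (3 * n + 1 + 1),
    Nat.factorial_succ (3 * n + 1), Nat.factorial_succ (3 * n), Nat.factorial_succ n, ← h1] at h2
  have h3 : 0 < (n + 1) * n.factorial ^ 3 := by positivity
  refine Nat.eq_of_mul_eq_mul_right h3 ?_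
  linear_combination h2

theorem tripleChoose_eq_div (n : ℕ) :
    tripleChoose n = (3 * n).factorial / n.factorial ^ 3 := by
  rw [← tripleChoose_mul_factorial, Nat.mul_div_cancel _ (by positivity)]

theorem three_ne_zero_zmod (hp : 5 ≤ p) : (3 : ZMod p) ≠ 0 := by
  intro h
  have : p ∣ 3 := (ZMod.natCast_eq_zero_iff 3 p).1 (by exact_mod_cast h)
  exact absurd (Nat.le_of_dvd (by norm_num) this) (by omega)

theorem natCast_ne_zero_of_lt {n : ℕ} (h0 : 0 < n) (h : n < p) : (n : ZMod p) ≠ 0 := by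
  intro h'
  exact absurd (Nat.le_of_dvd h0 ((ZMod.natCast_eq_zero_iff n p).1 h')) (by omega)

theorem legendreSym_neg_three (hp : 5 ≤ p) :
    legendreSym p (-3) = legendreSym 3 p := by
  have h3 : legendreSym p 3 = (-1) ^ (p / 2) * legendreSym 3 p := by
    have := legendreSym.quadratic_reciprocity' (p := 3) (q := p) (by norm_num) (by omega)
    simpa using this
  have h1 : legendreSym p (-1) = (-1) ^ (p / 2) := by
    rw [legendreSym.at_neg_one (by omega), ZMod.χ₄_eq_neg_one_pow]
    exact (Fact.out : p.Prime).eq_two_or_odd.resolve_left (by omega)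
  rw [show (-3 : ℤ) = -1 * 3 by norm_num, legendreSym.mul, h1, h3, ← mul_assoc, ← mul_pow]
  simp

theorem del_of_mod_one (hp : 5 ≤ p) (h : p % 3 = 1) : del p = 0 := by
  rw [del, legendreSym_neg_three p hp, legendreSym.mod, show ((p : ℤ) % ((3 : ℕ) : ℤ)) = 1 by omega]
  simp

theorem del_of_mod_two (hp : 5 ≤ p) (h : p % 3 = 2) : del p = 1 := by
  rw [del, legendreSym_neg_three p hp, legendreSym.mod, show ((p : ℤ) % ((3 : ℕ) : ℤ)) = 2 by omega,
    show legendreSym 3 2 = -1 by decide]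
  simp

theorem natCast_self_eq :
    (3 * (p / 3 : ℕ) + (p % 3 : ℕ) : ZMod p) = 0 := by
  have := congrArg (Nat.cast : ℕ → ZMod p) (Nat.div_add_mod p 3)
  push_cast at this
  simpa using this

theorem prime_mod_three (hp : 5 ≤ p) : p % 3 = 1 ∨ p % 3 = 2 := by
  have h : ¬ 3 ∣ p := fun h => by
    have := (Nat.prime_dvd_prime_iff_eq Nat.prime_three (Fact.out : p.Prime)).1 h
    omega
  omega

theorem poch_factor (hp : 5 ≤ p) (n : ℕ) :
    (-(p / 3 : ℕ) + n : ZMod p) * (2 / 3 - (del p : ZMod p) / 3 + n) * 27 =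
      3 * ((3 * n + 1) * (3 * n + 2)) := by
  have h3 := three_ne_zero_zmod p hp
  have hq := natCast_self_eq p
  rcases prime_mod_three p hp with h | h
  · rw [del_of_mod_one p hp h]
    rw [h] at hq
    have : (-(p / 3 : ℕ) : ZMod p) = 1 / 3 := by
      field_simp
      push_cast at hq
      linear_combination -hq
    rw [this]
    field_simp
    push_cast
    ring
  · rw [del_of_mod_two p hp h]
    rw [h] at hq
    have : (-(p / 3 : ℕ) : ZMod p) = 2 / 3 := by
      field_simp
      push_cast at hq
      linear_combination -hq
    rw [this]
    field_simp
    push_cast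
    ring

theorem ss3_coeff (hp : 5 ≤ p) (n : ℕ) (hn : n < p) :
    poch p (-(p / 3 : ℕ) : ZMod p) n * poch p ((2 : ZMod p) / 3 - (del p : ZMod p) / 3) n /
      ((n.factorial : ZMod p)) ^ 2 * 27 ^ n = tripleChoose n := by
  induction n with
  | zero => simp [poch, tripleChoose_zero]
  | succ n ih =>
    have h1 := natCast_ne_zero_of_lt p (Nat.succ_pos n) hn
    have h2 : (n.factorial : ZMod p) ≠ 0 := by
      intro h
      have := (Fact.out : p.Prime).dvd_factorial.1 ((ZMod.natCast_eq_zero_iff _ p).1 h)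
      omega
    have ih := ih (by omega)
    have hr := congrArg (Nat.cast : ℕ → ZMod p) (tripleChoose_succ n)
    have hf := poch_factor p hp n
    simp only [poch, ascPochhammer_succ_eval] at ih ⊢
    rw [Nat.factorial_succ]
    push_cast at hr h1 ⊢
    refine mul_left_cancel₀ (pow_ne_zero 2 h1) ?_
    rw [hr, ← ih, ← hf]
    field_simp
    ring

theorem ss3Poly_eq (hp : 5 ≤ p) :
    ss3Poly p = ∑ n ∈ Finset.range (p / 3 + 1),
      C (tripleChoose n : ZMod p) * X ^ (p / 3 + del p - n) := by
  refine Finset.sum_congr rfl fun n hn => ?_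
  rw [ss3_coeff p hp n (by have := Finset.mem_range.1 hn; omega)]

theorem ss3Poly_monic (hp : 5 ≤ p) :
    (ss3Poly p).natDegree = p / 3 + del p ∧ ss3Poly p ≠ 0 := by
  have hc : (ss3Poly p).coeff (p / 3 + del p) = 1 := by
    rw [ss3Poly_eq p hp, finsetSum_coeff, Finset.sum_eq_single 0]
    · simp [tripleChoose_zero]
    · intro n hn hn0
      have := Finset.mem_range.1 hn
      rw [coeff_C_mul, coeff_X_pow, if_neg (by omega), mul_zero]
    · simp
  refine ⟨le_antisymm ?_ (le_natDegree_of_ne_zero (by rw [hc]; exact one_ne_zero)), ?_⟩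
  · rw [ss3Poly_eq p hp]
    refine natDegree_sum_le_of_forall_le _ _ fun n _ => ?_
    exact (natDegree_C_mul_X_pow_le _ _).trans (by omega)
  · rintro h
    simp [h] at hc

theorem pow_card_sub_one_eq_ite (x : ZMod p) :
    x ^ (p - 1) = 1 - if x = 0 then 1 else 0 := by
  have hp := (Fact.out : p.Prime).two_le
  split_ifs with h
  · rw [h, zero_pow (by omega)]
    ring
  · rw [ZMod.pow_card_sub_one_eq_one h, sub_zero]

theorem sum_pow_zmod {n : ℕ} (hn : n < 2 * (p - 1)) :
    ∑ x : ZMod p, x ^ n = if n = p - 1 then -1 else 0 := by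
  have hp := (Fact.out : p.Prime).two_le
  rcases lt_trichotomy n (p - 1) with h | h | h
  · rw [if_neg h.ne]
    exact FiniteField.sum_pow_lt_card_sub_one _ _ (by rwa [ZMod.card])
  · rw [if_pos h, h]
    simp [pow_card_sub_one_eq_ite]
  · rw [if_neg h.ne']
    rw [← FiniteField.sum_pow_lt_card_sub_one (ZMod p) (n - (p - 1)) (by rw [ZMod.card]; omega)]
    refine Finset.sum_congr rfl fun x _ => ?_
    by_cases hx : x = 0
    · rw [hx, zero_pow (by omega), zero_pow (by omega)]
    · conv_lhs => rw [show n = (n - (p - 1)) + (p - 1) by omega]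
      rw [pow_add, ZMod.pow_card_sub_one_eq_one hx, mul_one]

/-- A beta-type sum over `𝔽_p`. -/
theorem sum_pow_mul_sub_pow (c : ZMod p) {i j r : ℕ} (hij : i + j = p - 1)
    (hr : j + r < 2 * (p - 1)) :
    ∑ b : ZMod p, b ^ j * (c - b) ^ r = (-1) ^ (i + 1) * r.choose i * c ^ (r - i) := by
  have h1 : ∀ b : ZMod p, b ^ j * (c - b) ^ r =
      ∑ l ∈ Finset.range (r + 1), (-1) ^ l * c ^ (r - l) * r.choose l * b ^ (j + l) := by
    intro b
    rw [show c - b = -b + c by ring, add_pow, Finset.mul_sum]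
    refine Finset.sum_congr rfl fun l _ => ?_
    rw [neg_pow b l, pow_add]
    ring
  rw [Finset.sum_congr rfl fun b _ => h1 b, Finset.sum_comm]
  have h2 : ∀ l ∈ Finset.range (r + 1),
      ∑ b : ZMod p, (-1) ^ l * c ^ (r - l) * r.choose l * b ^ (j + l) =
        if l = i then (-1) ^ (i + 1) * r.choose i * c ^ (r - i) else 0 := by
    intro l hl
    have := Finset.mem_range.1 hl
    rw [← Finset.mul_sum, sum_pow_zmod p (by omega)]
    by_cases h : l = i
    · rw [if_pos (by omega), if_pos h, h]
      ring
    · rw [if_neg (by omega), if_neg h, mul_zero]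
  rw [Finset.sum_congr rfl h2, Finset.sum_ite_eq']
  split_ifs with h
  · rfl
  · rw [Nat.choose_eq_zero_of_lt (by simpa using h)]
    simp

theorem cast_choose_sub_one_sub (a b : ℕ) (h : a + b ≤ p - 1) :
    ((p - 1 - a).choose b : ZMod p) = (-1) ^ b * (a + b).choose b := by
  have hp := (Fact.out : p.Prime).two_le
  induction b with
  | zero => simp
  | succ b ih =>
    have ih := ih (by omega)
    have h1 := congrArg (Nat.cast : ℕ → ZMod p) (Nat.choose_succ_right_eq (p - 1 - a) b)
    have h2 := congrArg (Nat.cast : ℕ → ZMod p) (Nat.add_one_mul_choose_eq (a + b) b)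
    have h3 : ((p - 1 - a - b : ℕ) : ZMod p) = -(a + b + 1) := by
      have := congrArg (Nat.cast : ℕ → ZMod p) (show (p - 1 - a - b) + (a + b + 1) = p by omega)
      push_cast at this
      rw [ZMod.natCast_self] at this
      linear_combination this
    have h4 := natCast_ne_zero_of_lt p (Nat.succ_pos b) (by omega)
    push_cast at h1 h2 h4 ⊢
    rw [h3, ih] at h1
    refine mul_right_cancel₀ h4 ?_
    rw [h1, ← add_assoc, pow_succ]
    linear_combination -(-1) ^ b * h2

theorem cast_choose_mul_choose (hp : 5 ≤ p) (i : ℕ) :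
    ((p - 1 - i).choose i * (p - 1 - 2 * i).choose i : ZMod p) =
      if i < p / 3 + 1 then (tripleChoose i : ZMod p) else 0 := by
  have h3 := prime_mod_three p hp
  split_ifs with h
  · rw [cast_choose_sub_one_sub p i i (by omega), cast_choose_sub_one_sub p (2 * i) i (by omega),
      tripleChoose]
    rw [show i + i = 2 * i by ring, show 2 * i + i = 3 * i by ring]
    push_cast
    have : ((-1 : ZMod p) ^ i) ^ 2 = 1 := by
      rw [← pow_mul, mul_comm, pow_mul]
      simp
    linear_combination ((3 * i).choose i * (2 * i).choose i : ZMod p) * this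
  · by_cases h' : i ≤ p - 1 - i
    · rw [Nat.choose_eq_zero_of_lt (show p - 1 - 2 * i < i by omega)]
      simp
    · rw [Nat.choose_eq_zero_of_lt (show p - 1 - i < i by omega)]
      simp

/-- The affine points of the curve `ab(1 - a - b) = t`, a model of an elliptic curve
with a rational point of order three. -/
def cubicPoints (t : ZMod p) : Finset (ZMod p × ZMod p) :=
  Finset.univ.filter fun x => x.1 * x.2 * (1 - x.1 - x.2) = t

theorem sub_pow_card_sub_one_eq (x y : ZMod p) :
    (x - y) ^ (p - 1) = ∑ i ∈ Finset.range p, y ^ i * x ^ (p - 1 - i) := by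
  have hp := (Fact.out : p.Prime).two_le
  by_cases h : x = y
  · subst h
    rw [sub_self, zero_pow (by omega)]
    symm
    rw [Finset.sum_congr rfl fun i hi => show x ^ i * x ^ (p - 1 - i) = x ^ (p - 1) by
      rw [← pow_add]; congr 1; have := Finset.mem_range.1 hi; omega]
    simp
  · have h1 := Commute.geom_sum₂_mul (Commute.all y x) p
    refine mul_right_cancel₀ (sub_ne_zero.2 h) ?_
    rw [← pow_succ, Nat.sub_add_cancel (by omega), sub_pow_char]
    linear_combination h1

theorem sum_sum_cubic_pow {i : ℕ} (h0 : 0 < i) (hi : i < p) :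
    ∑ a : ZMod p, ∑ b : ZMod p, (a * b * (1 - a - b)) ^ (p - 1 - i) =
      (p - 1 - i).choose i * (p - 1 - 2 * i).choose i := by
  have h1 : ∀ a : ZMod p, ∑ b : ZMod p, (a * b * (1 - a - b)) ^ (p - 1 - i) =
      (-1) ^ (i + 1) * (p - 1 - i).choose i * (a ^ (p - 1 - i) * (1 - a) ^ (p - 1 - i - i)) := by
    intro a
    have := sum_pow_mul_sub_pow p (1 - a) (i := i) (j := p - 1 - i) (r := p - 1 - i)
      (by omega) (by omega)
    simp only [mul_pow, mul_assoc, ← Finset.mul_sum] at this ⊢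
    rw [this]
    ring
  rw [Finset.sum_congr rfl fun a _ => h1 a, ← Finset.mul_sum,
    sum_pow_mul_sub_pow p 1 (i := i) (by omega) (by omega), one_pow,
    show p - 1 - i - i = p - 1 - 2 * i by omega]
  have : ((-1 : ZMod p) ^ (i + 1)) ^ 2 = 1 := by
    rw [← pow_mul, mul_comm, pow_mul]
    simp
  linear_combination ((p - 1 - i).choose i * (p - 1 - 2 * i).choose i : ZMod p) * this

theorem sum_sum_cubic_pow_card_sub_one :
    ∑ a : ZMod p, ∑ b : ZMod p, (a * b * (1 - a - b)) ^ (p - 1) = 3 := by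
  have h1 : ∀ a : ZMod p, ∑ b : ZMod p, (a * b * (1 - a - b)) ^ (p - 1) =
      a ^ (p - 1) * (-2 + if a = 1 then 1 else 0) := by
    intro a
    simp only [mul_pow, mul_assoc, ← Finset.mul_sum]
    congr 1
    simp only [pow_card_sub_one_eq_ite, sub_mul, mul_sub, one_mul, mul_one, Finset.sum_sub_distrib,
      ite_mul, zero_mul]
    have h : 0 = 1 - a ↔ a = 1 := by rw [eq_comm, sub_eq_zero, eq_comm]
    have h' : ∀ x, (1 - a - x = 0) ↔ x = 1 - a := fun x => by rw [sub_eq_zero, eq_comm]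
    simp [h, h']
    ring
  rw [Finset.sum_congr rfl fun a _ => h1 a]
  simp only [pow_card_sub_one_eq_ite, sub_mul, mul_add, one_mul, Finset.sum_sub_distrib,
      Finset.sum_add_distrib, ite_mul, zero_mul]
  simp
  norm_num

theorem card_cubicPoints_cast (hp : 5 ≤ p) (t : ZMod p) :
    ((cubicPoints p t).card : ZMod p) =
      -2 - ∑ n ∈ Finset.range (p / 3 + 1), (tripleChoose n : ZMod p) * t ^ n := by
  have h1 : ((cubicPoints p t).card : ZMod p) =
      -∑ a : ZMod p, ∑ b : ZMod p, (a * b * (1 - a - b) - t) ^ (p - 1) := by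
    rw [cubicPoints, Finset.card_filter, Nat.cast_sum, ← Fintype.sum_prod_type']
    simp only [pow_card_sub_one_eq_ite, sub_eq_zero]
    rw [Finset.sum_sub_distrib]
    simp
  have h2 : ∑ a : ZMod p, ∑ b : ZMod p, (a * b * (1 - a - b) - t) ^ (p - 1) =
      ∑ i ∈ Finset.range p, t ^ i *
        ∑ a : ZMod p, ∑ b : ZMod p, (a * b * (1 - a - b)) ^ (p - 1 - i) := by
    simp only [sub_pow_card_sub_one_eq, Finset.mul_sum]
    rw [Finset.sum_comm]
    rw [Finset.sum_congr rfl fun b _ => Finset.sum_comm]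
    rw [Finset.sum_comm]
    exact Finset.sum_congr rfl fun b _ => Finset.sum_comm
  have h3 : ∀ i ∈ Finset.range p, t ^ i *
        ∑ a : ZMod p, ∑ b : ZMod p, (a * b * (1 - a - b)) ^ (p - 1 - i) =
      (if i < p / 3 + 1 then (tripleChoose i : ZMod p) * t ^ i else 0) +
        if i = 0 then 2 else 0 := by
    intro i hi
    rcases Nat.eq_zero_or_pos i with rfl | h0
    · rw [Nat.sub_zero, sum_sum_cubic_pow_card_sub_one]
      simp [tripleChoose_zero]
      norm_num
    · rw [sum_sum_cubic_pow p h0 (Finset.mem_range.1 hi), cast_choose_mul_choose p hp,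
        if_neg h0.ne']
      split_ifs <;> ring
  rw [h1, h2, Finset.sum_congr rfl h3, Finset.sum_add_distrib, Finset.sum_ite_eq',
    if_pos (Finset.mem_range.2 (by omega)), ← Finset.sum_filter]
  have : (Finset.range p).filter (fun i => i < p / 3 + 1) = Finset.range (p / 3 + 1) := by
    ext i
    simp only [Finset.mem_filter, Finset.mem_range]
    omega
  rw [this]
  ring

theorem card_cubicPoints_mod_three (hp : 5 ≤ p) (t : ZMod p) :
    (cubicPoints p t).card % 3 = 0 ∨ (cubicPoints p t).card % 3 = 1 := by
  let f : Function.End (cubicPoints p t) := fun x => ⟨(x.1.2, 1 - x.1.1 - x.1.2), by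
    have := x.2
    simp only [cubicPoints, Finset.mem_filter, Finset.mem_univ, true_and] at this ⊢
    linear_combination this⟩
  have hf : f ^ 3 ^ 1 = 1 := by
    funext x
    change f (f (f x)) = x
    ext
    · simp [f]
    · simp only [f]
      ring
  have : Fact (Nat.Prime 3) := ⟨Nat.prime_three⟩
  have h1 := Equiv.Perm.card_fixedPoints_modEq hf
  have h2 : Fintype.card (Function.fixedPoints f) ≤ 1 := by
    rw [Fintype.card_le_one_iff_subsingleton]
    have key : ∀ x : Function.fixedPoints f, 3 * x.1.1.1 = 1 ∧ x.1.1.2 = x.1.1.1 := by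
      intro x
      have hx : f x.1 = x.1 := x.2
      have hx' := congrArg Subtype.val hx
      have h1 : x.1.1.2 = x.1.1.1 := congrArg Prod.fst hx'
      have h2 : 1 - x.1.1.1 - x.1.1.2 = x.1.1.2 := congrArg Prod.snd hx'
      exact ⟨by linear_combination -h2 - 2 * h1, h1⟩
    refine ⟨fun x y => Subtype.ext (Subtype.ext (Prod.ext ?_ ?_))⟩
    · exact mul_left_cancel₀ (three_ne_zero_zmod p hp) ((key x).1.trans (key y).1.symm)
    · rw [(key x).2, (key y).2]
      exact mul_left_cancel₀ (three_ne_zero_zmod p hp) ((key x).1.trans (key y).1.symm)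
  rw [Fintype.card_coe] at h1
  unfold Nat.ModEq at h1
  omega

theorem card_cubicPoints_fiber_le (t : ZMod p) (ht : t ≠ 0) (a : ZMod p) :
    ((cubicPoints p t).filter fun x => x.1 = a).card ≤ if a = 0 then 0 else 2 := by
  have hmem : ∀ x ∈ (cubicPoints p t).filter fun x => x.1 = a,
      x.1 = a ∧ a * x.2 * (1 - a - x.2) = t := by
    intro x hx
    simp only [cubicPoints, Finset.mem_filter, Finset.mem_univ, true_and] at hx
    exact ⟨hx.2, by rw [← hx.2]; exact hx.1⟩
  rcases Finset.eq_empty_or_nonempty ((cubicPoints p t).filter fun x => x.1 = a) with h | ⟨y, hy⟩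
  · rw [h]
    simp
  · have hy := hmem y hy
    have ha : a ≠ 0 := by
      rintro rfl
      exact ht (by rw [← hy.2]; ring)
    rw [if_neg ha]
    refine (Finset.card_le_card (t := {(a, y.2), (a, 1 - a - y.2)}) fun x hx => ?_).trans
      Finset.card_le_two
    have hx := hmem x hx
    have h : a * ((x.2 - y.2) * (x.2 - (1 - a - y.2))) = 0 := by
      linear_combination hy.2 - hx.2
    have h := (mul_eq_zero.1 h).resolve_left ha
    rw [Finset.mem_insert, Finset.mem_singleton]
    rcases mul_eq_zero.1 h with h | h
    · exact Or.inl (Prod.ext hx.1 (sub_eq_zero.1 h))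
    · exact Or.inr (Prod.ext hx.1 (sub_eq_zero.1 h))

theorem sum_ite_zero_two : ∑ a : ZMod p, (if a = 0 then 0 else 2) = 2 * (p - 1) := by
  rw [Finset.sum_ite, Finset.sum_const_zero, zero_add, Finset.sum_const, smul_eq_mul,
    Finset.filter_ne', Finset.card_erase_of_mem (Finset.mem_univ _), Finset.card_univ, ZMod.card,
    mul_comm]

theorem card_cubicPoints_lt (hp : 5 ≤ p) (t : ZMod p) (ht : t ≠ 0) :
    (cubicPoints p t).card < 2 * (p - 1) := by
  have hfib : (cubicPoints p t).card =
      ∑ a : ZMod p, ((cubicPoints p t).filter fun x => x.1 = a).card :=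
    Finset.card_eq_sum_card_fiberwise fun _ _ => Finset.mem_coe.2 (Finset.mem_univ _)
  have hle := Finset.sum_le_sum fun a (_ : a ∈ Finset.univ) => card_cubicPoints_fiber_le p t ht a
  rw [← hfib, sum_ite_zero_two] at hle
  refine lt_of_le_of_ne hle fun heq => ?_
  have hall : ∀ a : ZMod p,
      ((cubicPoints p t).filter fun x => x.1 = a).card = if a = 0 then 0 else 2 := by
    have := (Finset.sum_eq_sum_iff_of_le
      fun a (_ : a ∈ Finset.univ) => card_cubicPoints_fiber_le p t ht a).1
      (by rw [← hfib, sum_ite_zero_two, heq])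
    exact fun a => this a (Finset.mem_univ _)
  have h1 : ∑ x ∈ cubicPoints p t, x.1 = 0 := by
    rw [← Finset.sum_fiberwise_of_maps_to (t := Finset.univ) (g := Prod.fst)
      fun _ _ => Finset.mem_univ _]
    have h : ∀ a : ZMod p, ∑ x ∈ (cubicPoints p t).filter (fun x => x.1 = a), x.1 = 2 * a ^ 1 := by
      intro a
      rw [Finset.sum_congr rfl fun x hx => (Finset.mem_filter.1 hx).2, Finset.sum_const, hall]
      split_ifs with h
      · simp [h]
      · simp
    rw [Finset.sum_congr rfl fun a _ => h a, ← Finset.mul_sum, sum_pow_zmod p (by omega),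
      if_neg (by omega), mul_zero]
  have h2 : ∑ x ∈ cubicPoints p t, x.2 = 0 := by
    rw [← h1]
    refine Finset.sum_nbij' Prod.swap Prod.swap ?_ ?_ (by simp) (by simp) (by simp)
    all_goals
      intro x hx
      simp only [cubicPoints, Finset.mem_filter, Finset.mem_univ, true_and, Prod.fst_swap,
        Prod.snd_swap] at hx ⊢
      linear_combination hx
  have h3 : ∑ x ∈ cubicPoints p t, (1 - x.1 - x.2) = 0 := by
    rw [← h1]
    refine Finset.sum_nbij' (fun x => (1 - x.1 - x.2, x.1)) (fun x => (x.2, 1 - x.1 - x.2))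
      ?_ ?_ (fun x _ => Prod.ext (by simp) (by ring)) (by simp) (by simp)
    all_goals
      intro x hx
      simp only [cubicPoints, Finset.mem_filter, Finset.mem_univ, true_and] at hx ⊢
      linear_combination hx
  rw [Finset.sum_sub_distrib, Finset.sum_sub_distrib, h1, h2, Finset.sum_const, heq] at h3
  have h4 := natCast_ne_zero_of_lt p (n := 2) (by omega) (by omega)
  rw [nsmul_one] at h3
  push_cast [Nat.cast_sub (show 1 ≤ p by omega)] at h3 h4
  rw [ZMod.natCast_self] at h3
  exact h4 (by linear_combination -h3)

theorem sum_tripleChoose_ne_zero (hp : 5 ≤ p) (h : p % 3 = 1) (t : ZMod p) (ht : t ≠ 0) :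
    ∑ n ∈ Finset.range (p / 3 + 1), (tripleChoose n : ZMod p) * t ^ n ≠ 0 := by
  intro h0
  have h1 := card_cubicPoints_cast p hp t
  have h2 := card_cubicPoints_mod_three p hp t
  have h3 := card_cubicPoints_lt p hp t ht
  rw [h0] at h1
  have h4 : (((cubicPoints p t).card + 2 : ℕ) : ZMod p) = 0 := by
    push_cast
    rw [h1]
    ring
  obtain ⟨c, hc⟩ := (ZMod.natCast_eq_zero_iff _ p).1 h4
  have : c = 1 := by
    have h5 : c < 2 := lt_of_mul_lt_mul_left (show p * c < p * 2 by omega) (Nat.zero_le p)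
    have : c ≠ 0 := by
      rintro rfl
      omega
    omega
  subst this
  omega

theorem L3_eq_zero (hp : 5 ≤ p) (h : p % 3 = 1) : L3 p = 0 := by
  rw [L3, Finset.card_eq_zero, Multiset.toFinset_eq_empty, Multiset.eq_zero_iff_forall_notMem]
  intro x hx
  have hx := (mem_roots'.1 hx).2
  rw [IsRoot.def, ss3Poly_eq p hp, eval_finsetSum, del_of_mod_one p hp h] at hx
  simp only [eval_mul, eval_C, eval_pow, eval_X, add_zero] at hx
  by_cases h0 : x = 0
  · rw [Finset.sum_eq_single (p / 3)] at hx
    · rw [Nat.sub_self, pow_zero, mul_one, ZMod.natCast_eq_zero_iff] at hx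
      have h1 := tripleChoose_mul_factorial (p / 3)
      have h2 := (Fact.out : p.Prime).dvd_factorial.1 (h1 ▸ hx.mul_right _)
      omega
    · intro n hn hne
      have := Finset.mem_range.1 hn
      rw [h0, zero_pow (by omega), mul_zero]
    · simp
  · refine sum_tripleChoose_ne_zero p hp h x⁻¹ (inv_ne_zero h0) ?_
    refine (mul_eq_zero.1 ?_).resolve_left (pow_ne_zero (p / 3) h0)
    rw [← hx, Finset.mul_sum]
    refine Finset.sum_congr rfl fun n hn => ?_
    have := Finset.mem_range.1 hn
    rw [pow_sub₀ x h0 (by omega), inv_pow]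
    ring

/-- The Hasse invariant of the Hesse cubic `x³ + y³ + z³ = k x y z`, as a polynomial in `k`
(for `p ≡ 2 mod 3`). -/
def hessePoly : (ZMod p)[X] :=
  ∑ n ∈ Finset.range (p / 3 + 1), C (tripleChoose n : ZMod p) * X ^ (3 * (p / 3 - n) + 1)

theorem hesse_operator_monomial (c : ZMod p) (j : ℕ) :
    (27 - X ^ 3) * derivative (derivative (C c * X ^ (3 * j + 1)))
      - 3 * X ^ 2 * derivative (C c * X ^ (3 * j + 1)) - X * (C c * X ^ (3 * j + 1)) =
    C (27 * c * ((3 * j + 1) * (3 * j))) * X ^ (3 * j - 1)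
      - C (c * (3 * j + 2) ^ 2) * X ^ (3 * j + 2) := by
  cases j with
  | zero =>
    simp only [mul_zero, zero_add, Nat.cast_zero, pow_one, derivative_mul, derivative_C,
      derivative_X,
      zero_mul, mul_one, map_zero, map_mul, map_pow, map_ofNat]
    ring
  | succ j =>
    rw [show 3 * (j + 1) + 1 = 3 * j + 4 by ring, show 3 * (j + 1) - 1 = 3 * j + 2 by omega]
    simp only [derivative_mul, derivative_C, derivative_X_pow, zero_mul, zero_add,
      show 3 * j + 4 - 1 = 3 * j + 3 by omega,
      show 3 * j + 3 - 1 = 3 * j + 2 by omega]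
    simp only [map_mul, map_add, map_natCast, map_pow, Nat.cast_add, Nat.cast_mul, Nat.cast_ofNat,
      map_ofNat, map_one, Nat.cast_one]
    ring

theorem hessePoly_differential_equation (h : p % 3 = 2) :
    (27 - X ^ 3) * derivative (derivative (hessePoly p))
      - 3 * X ^ 2 * derivative (hessePoly p) - X * hessePoly p = 0 := by
  have hsum : (27 - X ^ 3) * derivative (derivative (hessePoly p))
      - 3 * X ^ 2 * derivative (hessePoly p) - X * hessePoly p =
      ∑ n ∈ Finset.range (p / 3 + 1),
        (C (27 * (tripleChoose n : ZMod p) * ((3 * (p / 3 - n : ℕ) + 1) * (3 * (p / 3 - n : ℕ))))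
            * X ^ (3 * (p / 3 - n) - 1)
          - C ((tripleChoose n : ZMod p) * (3 * (p / 3 - n : ℕ) + 2) ^ 2)
            * X ^ (3 * (p / 3 - n) + 2)) := by
    rw [hessePoly, derivative_sum, derivative_sum, Finset.mul_sum, Finset.mul_sum, Finset.mul_sum,
      ← Finset.sum_sub_distrib, ← Finset.sum_sub_distrib]
    exact Finset.sum_congr rfl fun n _ => hesse_operator_monomial p _ _
  have hq := natCast_self_eq p
  rw [h] at hq
  push_cast at hq
  rw [hsum, Finset.sum_sub_distrib, Finset.sum_range_succ, Finset.sum_range_succ', Nat.sub_self,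
    Nat.sub_zero, hq, sub_eq_zero]
  congr 1
  · refine Finset.sum_congr rfl fun n hn => ?_
    have hn := Finset.mem_range.1 hn
    have hr := congrArg (Nat.cast : ℕ → ZMod p) (tripleChoose_succ n)
    rw [show 3 * (p / 3 - (n + 1)) + 2 = 3 * (p / 3 - n) - 1 by omega]
    congr 2
    rw [Nat.cast_sub hn.le, Nat.cast_sub (show n + 1 ≤ p / 3 by omega)]
    push_cast at hr ⊢
    rw [show (3 * ((p / 3 : ℕ) - (n : ZMod p)) + 1) = -(3 * n + 1) by linear_combination hq,
      show (3 * ((p / 3 : ℕ) - (n : ZMod p))) = -(3 * n + 2) by linear_combination hq,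
      show (3 * ((p / 3 : ℕ) - ((n : ZMod p) + 1)) + 2) = -(3 * (n + 1)) by linear_combination hq]
    linear_combination -9 * hr
  · simp

theorem hessePoly_ne_zero (h : p % 3 = 2) : hessePoly p ≠ 0 ∧ (hessePoly p).natDegree < p := by
  constructor
  · intro h0
    have hc : (hessePoly p).coeff (3 * (p / 3) + 1) = 1 := by
      rw [hessePoly, finsetSum_coeff, Finset.sum_eq_single 0]
      · simp [tripleChoose_zero]
      · intro n hn hn0
        have := Finset.mem_range.1 hn
        rw [coeff_C_mul, coeff_X_pow, if_neg (by omega), mul_zero]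
      · simp
    simp [h0] at hc
  · refine lt_of_le_of_lt (b := p - 1) (natDegree_sum_le_of_forall_le _ _ fun n _ => ?_) (by omega)
    exact (natDegree_C_mul_X_pow_le _ _).trans (by omega)

theorem taylor_hessePoly_differential_equation (h : p % 3 = 2) :
    X * (X * derivative (X * derivative (taylor 3 (hessePoly p)))
      + 2 * (X * derivative (taylor 3 (hessePoly p))) + taylor 3 (hessePoly p))
      + 9 * (X * derivative (X * derivative (taylor 3 (hessePoly p))))
      + 9 * (X * derivative (taylor 3 (hessePoly p))) + 3 * taylor 3 (hessePoly p)
      + 27 * derivative (X * derivative (taylor 3 (hessePoly p))) = 0 := by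
  have h1 := congrArg (fun q => q.comp (X + C 3)) (hessePoly_differential_equation p h)
  simp only [taylor_apply, derivative_comp, derivative_mul, derivative_add, derivative_X,
    derivative_C, add_zero, one_mul]
  simp only [sub_comp, mul_comp, pow_comp, X_comp, zero_comp, ofNat_comp] at h1
  simp only [map_ofNat] at h1 ⊢
  linear_combination -h1

theorem taylor_hessePoly_recurrence (h : p % 3 = 2) :
    (3 * (taylor 3 (hessePoly p)).coeff 0 + 27 * (taylor 3 (hessePoly p)).coeff 1 = 0) ∧
    ∀ n : ℕ, (n + 1 : ZMod p) ^ 2 * (taylor 3 (hessePoly p)).coeff n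
      + (9 * (n + 1) ^ 2 + 9 * (n + 1) + 3) * (taylor 3 (hessePoly p)).coeff (n + 1)
      + 27 * (n + 2) ^ 2 * (taylor 3 (hessePoly p)).coeff (n + 2) = 0 := by
  have hode := taylor_hessePoly_differential_equation p h
  set A := taylor 3 (hessePoly p)
  have hθ : ∀ (B : (ZMod p)[X]) (n : ℕ), (X * derivative B).coeff n = n * B.coeff n := by
    intro B n
    cases n with
    | zero => simp
    | succ n =>
      rw [coeff_X_mul, coeff_derivative]
      push_cast
      ring
  constructor
  · have h0 := congrArg (fun q => q.coeff 0) hode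
    simp only [coeff_add, coeff_ofNat_mul, hθ, coeff_derivative, coeff_X_mul_zero, coeff_zero] at h0
    push_cast at h0
    linear_combination h0
  · intro n
    have h0 := congrArg (fun q => q.coeff (n + 1)) hode
    simp only [coeff_add, coeff_ofNat_mul, coeff_X_mul, hθ, coeff_derivative, coeff_zero] at h0
    push_cast at h0
    linear_combination h0

theorem taylor_hessePoly_coeff_zero_ne_zero (hp : 5 ≤ p) (h : p % 3 = 2) :
    (taylor 3 (hessePoly p)).coeff 0 ≠ 0 := by
  intro h0
  obtain ⟨h1, h2⟩ := taylor_hessePoly_recurrence p h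
  have h27 : (27 : ZMod p) ≠ 0 := by
    have := pow_ne_zero 3 (three_ne_zero_zmod p hp)
    norm_num at this
    exact this
  have key : ∀ n, n + 1 < p → (taylor 3 (hessePoly p)).coeff n = 0 ∧
      (taylor 3 (hessePoly p)).coeff (n + 1) = 0 := by
    intro n
    induction n with
    | zero =>
      intro _
      rw [h0, mul_zero, zero_add] at h1
      exact ⟨h0, (mul_eq_zero.1 h1).resolve_left h27⟩
    | succ n ih =>
      intro hn
      obtain ⟨ih1, ih2⟩ := ih (by omega)
      refine ⟨ih2, ?_⟩
      have h3 := h2 n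
      rw [ih1, ih2, mul_zero, mul_zero, zero_add, zero_add] at h3
      have h4 := natCast_ne_zero_of_lt p (Nat.succ_pos (n + 1)) hn
      push_cast at h4
      exact (mul_eq_zero.1 h3).resolve_left (mul_ne_zero h27 (pow_ne_zero 2 (by
        intro h5
        exact h4 (by linear_combination h5))))
  refine (hessePoly_ne_zero p h).1 (taylor_injective 3 ?_)
  rw [map_zero]
  ext n
  rw [coeff_zero]
  rcases lt_or_ge n p with hn | hn
  · cases n with
    | zero => exact h0
    | succ n => exact (key n hn).2
  · exact coeff_eq_zero_of_natDegree_lt (by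
      rw [natDegree_taylor]; exact (hessePoly_ne_zero p h).2.trans_le hn)

/-- The Taylor coefficients of `hessePoly` at `3` are self-reciprocal up to scaling. -/
theorem taylor_hessePoly_reciprocal (hp : 5 ≤ p) (h : p % 3 = 2) (n : ℕ) (hn : n < p) :
    (taylor 3 (hessePoly p)).coeff (p - 1 - n) * 27 ^ (p - 1 - n) *
        (taylor 3 (hessePoly p)).coeff 0 =
      (taylor 3 (hessePoly p)).coeff (p - 1) * 27 ^ (p - 1) *
        (taylor 3 (hessePoly p)).coeff n := by
  obtain ⟨h1, h2⟩ := taylor_hessePoly_recurrence p h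
  set a := (taylor 3 (hessePoly p)).coeff
  have h27 : (27 : ZMod p) ≠ 0 := by
    have := pow_ne_zero 3 (three_ne_zero_zmod p hp)
    norm_num at this
    exact this
  have key : ∀ n, n + 1 < p →
      a (p - 1 - n) * 27 ^ (p - 1 - n) * a 0 = a (p - 1) * 27 ^ (p - 1) * a n ∧
      a (p - 1 - (n + 1)) * 27 ^ (p - 1 - (n + 1)) * a 0 =
        a (p - 1) * 27 ^ (p - 1) * a (n + 1) := by
    intro n
    induction n with
    | zero =>
      intro _
      refine ⟨rfl, ?_⟩
      have h3 := h2 (p - 2)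
      have hc : ((p - 2 : ℕ) : ZMod p) = -2 := by
        rw [Nat.cast_sub (by omega), ZMod.natCast_self]
        simp
      rw [hc, show p - 2 + 1 = p - 1 by omega] at h3
      rw [show p - 1 - (0 + 1) = p - 2 by omega, show p - 1 = p - 2 + 1 by omega, pow_succ,
        show p - 2 + 1 = p - 1 by omega]
      linear_combination 27 ^ (p - 2) * a 0 * h3 - 27 ^ (p - 2) * a (p - 1) * h1
    | succ n ih =>
      intro hn
      obtain ⟨ih1, ih2⟩ := ih (by omega)
      refine ⟨ih2, ?_⟩
      have h3 := h2 n
      obtain ⟨N, hN⟩ : ∃ N, N = p - 1 - (n + 1 + 1) := ⟨_, rfl⟩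
      have h5 := h2 N
      have hc : (N : ZMod p) = -(n + 3) := by
        have := congrArg (Nat.cast : ℕ → ZMod p) (show N + (n + 3) = p by omega)
        push_cast at this
        rw [ZMod.natCast_self] at this
        linear_combination this
      rw [← hN]
      rw [show p - 1 - n = N + 2 by omega] at ih1
      rw [show p - 1 - (n + 1) = N + 1 by omega] at ih2
      rw [hc] at h5
      have h4 := natCast_ne_zero_of_lt p (Nat.succ_pos (n + 1)) hn
      push_cast at h4
      refine mul_left_cancel₀ (mul_ne_zero h27 (pow_ne_zero 2 h4)) ?_
      rw [pow_succ] at ih1 ih2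
      rw [pow_succ] at ih1
      linear_combination 27 * 27 ^ N * a 0 * h5 - a (p - 1) * 27 ^ (p - 1) * h3
        - (n + 1) ^ 2 * ih1 - (9 * (n + 1) ^ 2 + 9 * (n + 1) + 3) * ih2
  cases n with
  | zero => rfl
  | succ n => exact (key n hn).2

theorem omega_pow_card {K : Type*} [Field K] {p : ℕ} {ω : K} (h : p % 3 = 2)
    (hω : ω ^ 2 + ω + 1 = 0) : ω ^ p = ω ^ 2 := by
  have h3 : ω ^ 3 = 1 := by linear_combination (ω - 1) * hω
  conv_lhs => rw [← Nat.div_add_mod p 3, pow_add, pow_mul, h3, one_pow, one_mul, h]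

section Extension

variable {K : Type*} [Field K] [Algebra (ZMod p) K]

theorem aeval_ss3Poly (hp : 5 ≤ p) (h : p % 3 = 2) (y : K) :
    aeval (y ^ 3) (ss3Poly p) = y ^ 2 * aeval y (hessePoly p) := by
  rw [ss3Poly_eq p hp, del_of_mod_two p hp h, hessePoly, map_sum, map_sum, Finset.mul_sum]
  refine Finset.sum_congr rfl fun n hn => ?_
  have hn := Finset.mem_range.1 hn
  simp only [map_mul, aeval_C, map_pow, aeval_X]
  rw [← pow_mul, show 3 * (p / 3 + 1 - n) = 2 + (3 * (p / 3 - n) + 1) by omega, pow_add]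
  ring

theorem aeval_hessePoly_mul (ω y : K) (hω : ω ^ 3 = 1) :
    aeval (ω * y) (hessePoly p) = ω * aeval y (hessePoly p) := by
  rw [hessePoly, map_sum, map_sum, Finset.mul_sum]
  refine Finset.sum_congr rfl fun n _ => ?_
  simp only [map_mul, aeval_C, map_pow, aeval_X]
  rw [mul_pow, pow_succ ω, pow_mul, hω, one_pow]
  ring

theorem aeval_hessePoly_taylor (h : p % 3 = 2) (y : K) :
    aeval (3 + y) (hessePoly p) =
      ∑ n ∈ Finset.range p, algebraMap (ZMod p) K ((taylor 3 (hessePoly p)).coeff n) * y ^ n := by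
  have h1 : aeval y (taylor 3 (hessePoly p)) = aeval (3 + y) (hessePoly p) := by
    rw [taylor_apply, aeval_comp]
    congr 2
    simp [add_comm, map_ofNat (algebraMap (ZMod p) K) 3]
  rw [← h1, aeval_eq_sum_range' (by rw [natDegree_taylor]; exact (hessePoly_ne_zero p h).2)]
  simp only [Algebra.smul_def]

theorem aeval_hessePoly_three_ne_zero (hp : 5 ≤ p) (h : p % 3 = 2) :
    aeval (3 : K) (hessePoly p) ≠ 0 := by
  have h0 := aeval_hessePoly_taylor p h (0 : K)
  rw [add_zero, Finset.sum_eq_single 0 (fun n _ hn => by rw [zero_pow hn, mul_zero])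
    (fun h => absurd (Finset.mem_range.2 (by omega)) h), pow_zero, mul_one] at h0
  rw [h0]
  exact fun h1 => taylor_hessePoly_coeff_zero_ne_zero p hp h
    ((algebraMap (ZMod p) K).injective (h1.trans (map_zero _).symm))

/-- The roots of the Hasse invariant are stable under the involution of the Hesse pencil. -/
theorem aeval_hessePoly_involution (hp : 5 ≤ p) (h : p % 3 = 2) (y : K) (hy : y ≠ 0)
    (h0 : aeval (3 + y) (hessePoly p) = 0) : aeval (3 + 27 / y) (hessePoly p) = 0 := by
  rw [aeval_hessePoly_taylor p h] at h0 ⊢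
  set a := (taylor 3 (hessePoly p)).coeff with ha
  have ha0 : algebraMap (ZMod p) K (a 0) ≠ 0 := fun h1 =>
    taylor_hessePoly_coeff_zero_ne_zero p hp h
      ((algebraMap (ZMod p) K).injective (h1.trans (map_zero _).symm))
  refine (mul_eq_zero.1 (?_ : algebraMap (ZMod p) K (a 0) * y ^ (p - 1) * _ = 0)).resolve_left
    (mul_ne_zero ha0 (pow_ne_zero _ hy))
  rw [← Finset.sum_range_reflect, Finset.mul_sum,
    ← mul_zero (algebraMap (ZMod p) K (a (p - 1) * 27 ^ (p - 1))), ← h0, Finset.mul_sum]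
  refine Finset.sum_congr rfl fun n hn => ?_
  have hn := Finset.mem_range.1 hn
  have h1 := congrArg (algebraMap (ZMod p) K) (taylor_hessePoly_reciprocal p hp h n hn)
  rw [← ha] at h1
  simp only [map_mul, map_pow, map_ofNat] at h1 ⊢
  rw [← mul_assoc _ _ (y ^ n), ← h1, div_pow, show p - 1 = n + (p - 1 - n) by omega, pow_add,
    show n + (p - 1 - n) - n = p - 1 - n by omega]
  field_simp

theorem eq_of_cube_eq {ω A B : K} (hω : ω ^ 2 + ω + 1 = 0) (h : A ^ 3 = B ^ 3) :
    A = B ∨ A = ω * B ∨ B = ω * A := by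
  have h1 : (A - B) * ((A - ω * B) * (B - ω * A)) = 0 := by
    linear_combination (-ω) * h + (A - B) * A * B * hω
  rcases mul_eq_zero.1 h1 with h | h
  · exact Or.inl (sub_eq_zero.1 h)
  · rcases mul_eq_zero.1 h with h | h
    · exact Or.inr (Or.inl (sub_eq_zero.1 h))
    · exact Or.inr (Or.inr (sub_eq_zero.1 h))

theorem algebraMap_pow_card (a : ZMod p) :
    algebraMap (ZMod p) K a ^ p = algebraMap (ZMod p) K a := by
  rw [← map_pow, ZMod.pow_card]

theorem three_ne_zero_ext (hp : 5 ≤ p) : (3 : K) ≠ 0 := by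
  rw [← map_ofNat (algebraMap (ZMod p) K) 3]
  exact fun h => three_ne_zero_zmod p hp
    ((algebraMap (ZMod p) K).injective (h.trans (map_zero _).symm))

theorem omega_ne (hp : 5 ≤ p) {ω : K} (hω : ω ^ 2 + ω + 1 = 0) : ω - 1 ≠ 0 ∧ ω ≠ 0 := by
  constructor
  · intro h1
    exact three_ne_zero_ext p hp (K := K) (by linear_combination hω - (ω + 2) * h1)
  · rintro rfl
    norm_num at hω

theorem eq_zero_of_add_omega_mul (hp : 5 ≤ p) (h : p % 3 = 2) {ω : K} (hω : ω ^ 2 + ω + 1 = 0)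
    {a b : ZMod p} (hab : algebraMap (ZMod p) K a + ω * algebraMap (ZMod p) K b = 0) :
    a = 0 ∧ b = 0 := by
  have := charP_of_injective_algebraMap (algebraMap (ZMod p) K).injective p
  have h1 := congrArg (· ^ p) hab
  simp only [add_pow_char, mul_pow, algebraMap_pow_card, omega_pow_card h hω,
    zero_pow (Fact.out : p.Prime).ne_zero] at h1
  obtain ⟨hw1, hw0⟩ := omega_ne p hp hω
  have hb : algebraMap (ZMod p) K b = 0 := by
    refine (mul_eq_zero.1 (?_ : (ω * (ω - 1)) * _ = 0)).resolve_left (mul_ne_zero hw0 hw1)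
    linear_combination h1 - hab
  have ha : algebraMap (ZMod p) K a = 0 := by
    rw [hb, mul_zero, add_zero] at hab
    exact hab
  exact ⟨(algebraMap (ZMod p) K).injective (ha.trans (map_zero _).symm),
    (algebraMap (ZMod p) K).injective (hb.trans (map_zero _).symm)⟩

variable (ω : K)

/-- The parameter 3-isogenous to `y`, twisted by the cube root of unity `ω`. -/
def twist (y : ZMod p) : K :=
  3 + 27 / (ω * algebraMap (ZMod p) K y - 3)

variable {ω}

theorem omega_mul_sub_three_ne_zero (hp : 5 ≤ p) (h : p % 3 = 2) (hω : ω ^ 2 + ω + 1 = 0)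
    (y : ZMod p) : ω * algebraMap (ZMod p) K y - 3 ≠ 0 := by
  intro h0
  have := (eq_zero_of_add_omega_mul p hp h hω (a := -3) (b := y) (by
    simp only [map_neg, map_ofNat]
    linear_combination h0)).1
  exact three_ne_zero_zmod p hp (neg_eq_zero.1 this)

theorem twist_eq (hp : 5 ≤ p) (h : p % 3 = 2) (hω : ω ^ 2 + ω + 1 = 0) (y : ZMod p) :
    twist p ω y = 3 * (ω * algebraMap (ZMod p) K y + 6) / (ω * algebraMap (ZMod p) K y - 3) := by
  have := omega_mul_sub_three_ne_zero p hp h hω y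
  rw [twist]
  field_simp
  ring

theorem aeval_twist (hp : 5 ≤ p) (h : p % 3 = 2) (hω : ω ^ 2 + ω + 1 = 0) {y : ZMod p}
    (hy : eval (y ^ 3) (ss3Poly p) = 0) (hy0 : y ≠ 0) :
    aeval (twist p ω y ^ 3) (ss3Poly p) = 0 := by
  have h1 : aeval (algebraMap (ZMod p) K y) (hessePoly p) = 0 := by
    have h2 := aeval_ss3Poly p hp h y
    rw [coe_aeval_eq_eval, coe_aeval_eq_eval, hy] at h2
    rw [aeval_algebraMap_apply, coe_aeval_eq_eval,
      (mul_eq_zero.1 h2.symm).resolve_left (pow_ne_zero 2 hy0), map_zero]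
  rw [aeval_ss3Poly p hp h, twist, aeval_hessePoly_involution p hp h _
    (omega_mul_sub_three_ne_zero p hp h hω y), mul_zero]
  rw [show (3 : K) + (ω * algebraMap (ZMod p) K y - 3) = ω * algebraMap (ZMod p) K y by ring,
    aeval_hessePoly_mul p _ _ (by linear_combination (ω - 1) * hω), h1, mul_zero]

theorem twist_eq_omega_mul (hp : 5 ≤ p) (h : p % 3 = 2) (hω : ω ^ 2 + ω + 1 = 0) {y z : ZMod p}
    (hyz : twist p ω y = ω * twist p ω z) : z = -6 := by
  have hy := omega_mul_sub_three_ne_zero p hp h hω y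
  have hz := omega_mul_sub_three_ne_zero p hp h hω z
  rw [twist_eq p hp h hω, twist_eq p hp h hω] at hyz
  have h3 := three_ne_zero_ext p hp (K := K)
  field_simp at hyz
  obtain ⟨h1, h2⟩ := eq_zero_of_add_omega_mul p hp h hω (a := -2 * y * z - 18 - 3 * z + 6 * y)
    (b := -y * z + 3 * y + 3 * z + 18) (by
      simp only [map_neg, map_ofNat, map_add, map_sub, map_mul]
      set y' := algebraMap (ZMod p) K y
      set z' := algebraMap (ZMod p) K z
      linear_combination hyz + (6 * y' - 3 * z' + (ω - 2) * y' * z') * hω)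
  refine mul_left_cancel₀ (pow_ne_zero 2 (three_ne_zero_zmod p hp)) ?_
  linear_combination 2 * h2 - h1

theorem twist_cube_injective (hp : 5 ≤ p) (h : p % 3 = 2) (hω : ω ^ 2 + ω + 1 = 0) {y z : ZMod p}
    (hy6 : y ≠ -6) (hz6 : z ≠ -6) (hyz : twist p ω y ^ 3 = twist p ω z ^ 3) : y = z := by
  rcases eq_of_cube_eq hω hyz with h1 | h1 | h1
  · have hy := omega_mul_sub_three_ne_zero p hp h hω y
    have hz := omega_mul_sub_three_ne_zero p hp h hω z
    rw [twist, twist] at h1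
    have h3 := three_ne_zero_ext p hp (K := K)
    have h27 : (27 : K) ≠ 0 := by
      have := pow_ne_zero 3 h3
      norm_num at this
      exact this
    have h1 := add_left_cancel h1
    rw [div_eq_div_iff hy hz] at h1
    have h1 := mul_left_cancel₀ h27 h1
    refine (algebraMap (ZMod p) K).injective (mul_left_cancel₀ (omega_ne p hp hω).2 ?_)
    linear_combination -h1
  · exact absurd (twist_eq_omega_mul p hp h hω h1) hz6
  · exact absurd (twist_eq_omega_mul p hp h hω h1) hy6

theorem twist_cube_ne_algebraMap (hp : 5 ≤ p) (h : p % 3 = 2) (hω : ω ^ 2 + ω + 1 = 0)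
    {y : ZMod p} (hy0 : y ≠ 0) (hy3 : y ≠ 3) (hy6 : y ≠ -6) (hy : y ^ 2 - 6 * y - 18 ≠ 0)
    (x : ZMod p) : twist p ω y ^ 3 ≠ algebraMap (ZMod p) K x := by
  intro hx
  have := charP_of_injective_algebraMap (algebraMap (ZMod p) K).injective p
  have hω' : (ω ^ 2) ^ 2 + ω ^ 2 + 1 = 0 := by linear_combination (ω ^ 2 - ω + 1) * hω
  have hn := omega_mul_sub_three_ne_zero p hp h hω y
  have hn' := omega_mul_sub_three_ne_zero p hp h hω' y
  obtain ⟨hw1, hw0⟩ := omega_ne p hp hω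
  have h3 := three_ne_zero_ext p hp (K := K)
  have hconj : twist p ω y ^ p = twist p (ω ^ 2) y := by
    have hc (n : ZMod p) := algebraMap_pow_card p (K := K) n
    have hc3 := hc 3
    have hc27 := hc 27
    rw [map_ofNat] at hc3 hc27
    rw [twist, twist, add_pow_char, div_pow, sub_pow_char, mul_pow, hc, omega_pow_card h hω,
      hc3, hc27]
  have hcube : twist p (ω ^ 2) y ^ 3 = twist p ω y ^ 3 := by
    rw [← hconj, ← pow_mul, mul_comm p 3, pow_mul, hx, algebraMap_pow_card]
  have hy0' : algebraMap (ZMod p) K y ≠ 0 := by simpa using hy0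
  have hy3' : algebraMap (ZMod p) K y - 3 ≠ 0 := by
    have := (map_ne_zero (algebraMap (ZMod p) K)).2 (sub_ne_zero.2 hy3)
    simpa only [map_sub, map_ofNat] using this
  have hy6' : algebraMap (ZMod p) K y + 6 ≠ 0 := by
    have := (map_ne_zero (algebraMap (ZMod p) K)).2 (sub_ne_zero.2 hy6)
    simpa only [sub_neg_eq_add, map_add, map_ofNat] using this
  have hyq : algebraMap (ZMod p) K y ^ 2 - 6 * algebraMap (ZMod p) K y - 18 ≠ 0 := by
    have := (map_ne_zero (algebraMap (ZMod p) K)).2 hy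
    simpa only [map_sub, map_mul, map_pow, map_ofNat] using this
  rw [twist_eq p hp h hω, twist_eq p hp h hω'] at hcube
  generalize algebraMap (ZMod p) K y = u at *
  rcases eq_of_cube_eq hω hcube with h1 | h1 | h1
  · field_simp at h1
    refine mul_ne_zero (mul_ne_zero (pow_ne_zero 2 h3) (mul_ne_zero hw0 hw1)) hy0' ?_
    linear_combination -h1
  · field_simp at h1
    refine mul_ne_zero hw1 hyq ?_
    linear_combination -h1 + (ω - 1) * (u ^ 2 * (1 - ω) - 6 * u) * hω
  · field_simp at h1
    refine mul_ne_zero hw1 (mul_ne_zero hy6' hy3') ?_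
    linear_combination -h1 + (ω - 1) * (u ^ 2 * (1 - ω) + 3 * u) * hω

end Extension

theorem pow_three_bijective (h : p % 3 = 2) : Function.Bijective fun y : ZMod p => y ^ 3 := by
  refine Finite.injective_iff_bijective.1 ?_
  refine Function.LeftInverse.injective (g := fun x => x ^ (2 * (p / 3) + 1)) fun y => ?_
  change (y ^ 3) ^ (2 * (p / 3) + 1) = y
  rw [← pow_mul, show 3 * (2 * (p / 3) + 1) = p + (p - 1) by omega, pow_add, ZMod.pow_card,
    ← pow_succ', Nat.sub_add_cancel (by omega), ZMod.pow_card]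

theorem card_cube_roots_eq_L3 (hp : 5 ≤ p) (h : p % 3 = 2) :
    (Finset.univ.filter fun y : ZMod p => eval (y ^ 3) (ss3Poly p) = 0).card = L3 p := by
  have hb := pow_three_bijective p h
  rw [L3, ← Finset.card_image_of_injective _ hb.injective]
  congr 1
  ext x
  rw [Multiset.mem_toFinset, mem_roots (ss3Poly_monic p hp).2, IsRoot.def, Finset.mem_image]
  constructor
  · rintro ⟨y, hy, rfl⟩
    exact (Finset.mem_filter.1 hy).2
  · intro hx
    obtain ⟨y, rfl⟩ := hb.surjective x
    exact ⟨y, Finset.mem_filter.2 ⟨Finset.mem_univ _, hx⟩, rfl⟩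

/-- The parameters `y` for which `twist` may fail to leave `𝔽_p`. -/
def exceptional : Finset (ZMod p) :=
  Finset.univ.filter fun y => y = 0 ∨ y = -6 ∨ y ^ 2 - 6 * y - 18 = 0

theorem card_exceptional_le : (exceptional p).card ≤ 4 := by
  by_cases hr : ∃ r : ZMod p, r ^ 2 - 6 * r - 18 = 0
  · obtain ⟨r, hr⟩ := hr
    refine (Finset.card_le_card (t := {0, -6, r, 6 - r}) fun y hy => ?_).trans Finset.card_le_four
    simp only [exceptional, Finset.mem_filter, Finset.mem_univ, true_and] at hy
    simp only [Finset.mem_insert, Finset.mem_singleton]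
    rcases hy with hy | hy | hy
    · exact Or.inl hy
    · exact Or.inr (Or.inl hy)
    · have h1 : (y - r) * (y - (6 - r)) = 0 := by linear_combination hy - hr
      rcases mul_eq_zero.1 h1 with h1 | h1
      · exact Or.inr (Or.inr (Or.inl (sub_eq_zero.1 h1)))
      · exact Or.inr (Or.inr (Or.inr (sub_eq_zero.1 h1)))
  · refine (Finset.card_le_card (t := {0, -6}) fun y hy => ?_).trans
      (Finset.card_le_two.trans (by norm_num))
    simp only [exceptional, Finset.mem_filter, Finset.mem_univ, true_and] at hy
    simp only [Finset.mem_insert, Finset.mem_singleton]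
    rcases hy with hy | hy | hy
    · exact Or.inl hy
    · exact Or.inr hy
    · exact absurd ⟨y, hy⟩ hr

theorem two_mul_L3_le (hp : 5 ≤ p) (h : p % 3 = 2) : 2 * L3 p ≤ p / 3 + 5 := by
  classical
  let K := AlgebraicClosure (ZMod p)
  obtain ⟨ω, hω⟩ : ∃ ω : K, ω ^ 2 + ω + 1 = 0 := by
    obtain ⟨ω, hω⟩ := IsAlgClosed.exists_root (X ^ 2 + X + 1 : K[X]) (by
      rw [show (X ^ 2 + X + 1 : K[X]).degree = 2 by compute_degree!]
      norm_num)
    exact ⟨ω, by simpa using hω⟩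
  set Z := Finset.univ.filter fun y : ZMod p => eval (y ^ 3) (ss3Poly p) = 0 with hZ
  set R := (ss3Poly p).roots.toFinset.image (algebraMap (ZMod p) K) with hR
  set T := (Z \ exceptional p).image fun y => twist p ω y ^ 3 with hT
  have hZL : Z.card = L3 p := by
    rw [hZ]
    convert card_cube_roots_eq_L3 p hp h
  have hZE : ∀ y ∈ Z \ exceptional p, eval (y ^ 3) (ss3Poly p) = 0 ∧
      y ≠ 0 ∧ y ≠ -6 ∧ y ^ 2 - 6 * y - 18 ≠ 0 := by
    intro y hy
    simp only [hZ, exceptional, Finset.mem_sdiff, Finset.mem_filter, Finset.mem_univ, true_and,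
      not_or] at hy
    exact hy
  have hRcard : R.card = L3 p := by
    rw [hR, Finset.card_image_of_injective _ (algebraMap (ZMod p) K).injective, L3]
  have hTcard : L3 p ≤ T.card + 4 := by
    rw [hT, Finset.card_image_of_injOn, ← hZL]
    · have h1 := Finset.card_le_card_sdiff_add_card (s := Z) (t := exceptional p)
      have h2 := card_exceptional_le p
      omega
    · intro y hy z hz hyz
      exact twist_cube_injective p hp h hω (hZE y hy).2.2.1 (hZE z hz).2.2.1 hyz
  have hdisj : Disjoint R T := by
    rw [Finset.disjoint_left]
    intro x hxR hxT
    obtain ⟨r, -, rfl⟩ := Finset.mem_image.1 hxR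
    obtain ⟨y, hy, hyr⟩ := Finset.mem_image.1 hxT
    obtain ⟨h1, h2, h3, h4⟩ := hZE y hy
    refine twist_cube_ne_algebraMap p hp h hω h2 ?_ h3 h4 r hyr
    rintro rfl
    have h5 := aeval_ss3Poly p hp h (3 : ZMod p)
    rw [coe_aeval_eq_eval, h1] at h5
    exact mul_ne_zero (pow_ne_zero 2 (three_ne_zero_zmod p hp))
      (aeval_hessePoly_three_ne_zero p hp h) h5.symm
  have hsub : R ∪ T ⊆ ((ss3Poly p).map (algebraMap (ZMod p) K)).roots.toFinset := by
    intro x hx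
    rw [Multiset.mem_toFinset, mem_roots (map_ne_zero (ss3Poly_monic p hp).2), IsRoot.def,
      eval_map_algebraMap]
    rcases Finset.mem_union.1 hx with hx | hx
    · obtain ⟨r, hr, rfl⟩ := Finset.mem_image.1 hx
      rw [Multiset.mem_toFinset, mem_roots (ss3Poly_monic p hp).2, IsRoot.def] at hr
      rw [aeval_algebraMap_apply, coe_aeval_eq_eval, hr, map_zero]
    · obtain ⟨y, hy, rfl⟩ := Finset.mem_image.1 hx
      exact aeval_twist p hp h hω (hZE y hy).1 (hZE y hy).2.1
  have hle := (Finset.card_le_card hsub).trans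
    ((Multiset.toFinset_card_le _).trans (card_roots' _))
  rw [Finset.card_union_of_disjoint hdisj, natDegree_map, (ss3Poly_monic p hp).1,
    del_of_mod_two p hp h] at hle
  omega

theorem L3_eq_card_filter (hp : 5 ≤ p) (h : p % 3 = 2) :
    L3 p = ((Finset.range p).filter fun k => (∑ n ∈ Finset.range (p / 3 + 1),
      (3 * n).factorial / n.factorial ^ 3 * k ^ (p / 3 + 1 - n)) % p = 0).card := by
  have hmem (x : ZMod p) : x ∈ (ss3Poly p).roots ↔
      ∑ n ∈ Finset.range (p / 3 + 1), (tripleChoose n : ZMod p) * x ^ (p / 3 + 1 - n) = 0 := by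
    rw [mem_roots (ss3Poly_monic p hp).2, IsRoot.def, ss3Poly_eq p hp, del_of_mod_two p hp h,
      eval_finsetSum]
    simp only [eval_mul, eval_C, eval_pow, eval_X]
  rw [L3]
  refine Finset.card_nbij' ZMod.val (fun k : ℕ => (k : ZMod p)) ?_ ?_ ?_ ?_
  all_goals
    intro x hx
    simp only [Finset.coe_filter, Finset.mem_coe, Finset.mem_range,
      Set.mem_ofPred_eq, Multiset.mem_toFinset, hmem,
      ← tripleChoose_eq_div, ← Nat.dvd_iff_mod_eq_zero, ← ZMod.natCast_eq_zero_iff,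
      Nat.cast_sum, Nat.cast_mul, Nat.cast_pow, ZMod.natCast_val, ZMod.cast_id', id] at hx ⊢
  · exact ⟨ZMod.val_lt x, hx⟩
  · exact hx.2
  · exact ZMod.val_cast_of_lt hx.1

theorem not_dvd_of_dvd_factorial_pow {N k : ℕ} (hp : 77 ≤ p)
    (hN : N ∣ Nat.factorial 71 ^ k) : ¬ p ∣ N := by
  intro h
  have := (Fact.out : p.Prime).dvd_factorial.1
    ((Fact.out : p.Prime).dvd_of_dvd_pow (h.trans hN))
  omega

theorem prime_lt_cases (hp : 5 ≤ p) (h : p < 77) :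
    p ∈ [7, 13, 19, 31, 37, 43, 61, 67, 73] ∨ p ∈ [5, 11, 17, 23, 29, 41, 47, 53, 59, 71] := by
  have hprime := (Fact.out : p.Prime)
  interval_cases p <;> first | decide | (exfalso; revert hprime; norm_num)

theorem L3_small_values :
    (∀ [Fact (Nat.Prime 5)], L3 5 = 2) ∧ (∀ [Fact (Nat.Prime 11)], L3 11 = 4) ∧
    (∀ [Fact (Nat.Prime 17)], L3 17 = 4) ∧ (∀ [Fact (Nat.Prime 23)], L3 23 = 6) ∧
    (∀ [Fact (Nat.Prime 29)], L3 29 = 6) ∧ (∀ [Fact (Nat.Prime 41)], L3 41 = 8) ∧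
    (∀ [Fact (Nat.Prime 47)], L3 47 = 10) ∧ (∀ [Fact (Nat.Prime 53)], L3 53 = 6) ∧
    (∀ [Fact (Nat.Prime 59)], L3 59 = 12) ∧ (∀ [Fact (Nat.Prime 71)], L3 71 = 14) := by
  refine ⟨?_, ?_, ?_, ?_, ?_, ?_, ?_, ?_, ?_, ?_⟩
  all_goals
    intro _
    rw [L3_eq_card_filter _ (by norm_num) (by norm_num)]
    decide +kernel

/-- For every prime p ≥ 5: deg ss_p^{(3)} − L^{(3)}(p) ≤ 4 iff p divides the order of
Fischer's group Fi′₂₄, and deg ss_p^{(3)} − L^{(3)}(p) ≤ 10 iff p divides the order of the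
Monster group. -/
theorem ss3_quadratic_factor_bound_iff (hp : 5 ≤ p) :
    ((ss3Poly p).natDegree - L3 p ≤ 4 ↔ p ∣ fischer24Order)
      ∧ ((ss3Poly p).natDegree - L3 p ≤ 10 ↔ p ∣ monsterOrder) := by
  obtain ⟨hdeg, -⟩ := ss3Poly_monic p hp
  rw [hdeg]
  rcases lt_or_ge p 77 with hlt | hge
  · rcases prime_lt_cases p hp hlt with h | h
    · have h1 : p % 3 = 1 := by
        simp only [List.mem_cons, List.not_mem_nil, or_false] at h
        omega
      rw [del_of_mod_one p hp h1, L3_eq_zero p hp h1]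
      clear * - h
      simp only [List.mem_cons, List.not_mem_nil, or_false] at h
      rcases h with rfl | rfl | rfl | rfl | rfl | rfl | rfl | rfl | rfl <;> decide +kernel
    · have h1 : p % 3 = 2 := by
        simp only [List.mem_cons, List.not_mem_nil, or_false] at h
        omega
      rw [del_of_mod_two p hp h1]
      obtain ⟨h5, h11, h17, h23, h29, h41, h47, h53, h59, h71⟩ := L3_small_values
      simp only [List.mem_cons, List.not_mem_nil, or_false] at h
      rcases h with rfl | rfl | rfl | rfl | rfl | rfl | rfl | rfl | rfl | rfl
      · rw [h5]; decide +kernel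
      · rw [h11]; decide +kernel
      · rw [h17]; decide +kernel
      · rw [h23]; decide +kernel
      · rw [h29]; decide +kernel
      · rw [h41]; decide +kernel
      · rw [h47]; decide +kernel
      · rw [h53]; decide +kernel
      · rw [h59]; decide +kernel
      · rw [h71]; decide +kernel
  · have hF : ¬ p ∣ fischer24Order :=
      not_dvd_of_dvd_factorial_pow p hge (k := 21) (by decide +kernel)
    have hM : ¬ p ∣ monsterOrder :=
      not_dvd_of_dvd_factorial_pow p hge (k := 46) (by decide +kernel)
    have hbig : 10 < p / 3 + del p - L3 p := by
      rcases prime_mod_three p hp with h | h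
      · rw [del_of_mod_one p hp h, L3_eq_zero p hp h]
        omega
      · have := two_mul_L3_le p hp h
        rw [del_of_mod_two p hp h]
        omega
    exact ⟨iff_of_false (by omega) hF, iff_of_false (by omega) hM⟩
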